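/- Let (Ω,𝔉,ℙ) be a probability space, M a positive integer, and X_1,…,X_M random variables with X_i taking values in a measurable space E_i. Let γ > 0 and μ ∈ [0,γ], and for each i ∈ {1,…,M} let f_i : E_1×⋯×E_i → ℝ be measurable with 0 ≤ f_i(X_1,…,X_i) ≤ γ almost surely and 𝔼[f_i(X_1,…,X_i) | X_1,…,X_{i−1}] ≤ μ almost surely. Then for every t ∈ [μ,γ], ℙ( (1/M)·Σ_{i=1}^M f_i(X_1,…,X_i) > t ) < min{ 2^{−M·(t − μ·log₂ e)/γ}, e^{−2M·((t−μ)/γ)²} }. -/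

import Mathlib

open MeasureTheory ProbabilityTheory Real

/-- Hoeffding's bound on the moment generating function of a Bernoulli variable. -/
theorem bernoulli_mgf_le_exp {p : ℝ} (hp : p ∈ unitInterval) (h : ℝ) :
    1 + p * (exp h - 1) ≤ exp (p * h + h ^ 2 / 8) := by
  have key := (hasSubgaussianMGF_of_mem_Icc (X := fun x : ℝ ↦ x) (a := 0) (b := 1)
    (μ := bernoulliMeasure (1 : ℝ) 0 ⟨p, hp⟩) aemeasurable_id' (by
      rw [bernoulliMeasure_def, ae_add_measure_iff]
      constructor <;> refine Measure.ae_smul_measure ?_ _ <;> simp [ae_dirac_eq])).mgf_le h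
  simp only [mgf, integral_bernoulliMeasure] at key
  simp at key
  have e1 : exp (h * (1 - p)) = exp (-(p * h)) * exp h := by rw [← exp_add]; ring_nf
  have e2 : exp (-(h * p)) = exp (-(p * h)) := by ring_nf
  rw [e1, e2] at key
  have e3 : exp (p * h + h ^ 2 / 8) = exp (p * h) * exp ((2 ^ 2)⁻¹ * h ^ 2 / 2) := by
    rw [← exp_add]; ring_nf
  have e4 : exp (p * h) * exp (-(p * h)) = 1 := by rw [← exp_add]; simp
  rw [e3]
  refine le_trans (le_of_eq ?_) (mul_le_mul_of_nonneg_left key (exp_pos (p * h)).le)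
  linear_combination (-(1 - p) - p * exp h) * e4

/-- On `[0, γ]` the exponential lies below its chord. -/
theorem exp_mul_le_chord {γ s x : ℝ} (hγ : 0 < γ) (hx : x ∈ Set.Icc 0 γ) :
    exp (s * x) ≤ 1 + x / γ * (exp (s * γ) - 1) := by
  have h1 : x / γ ≤ 1 := (div_le_one hγ).2 hx.2
  have h := convexOn_exp.2 (Set.mem_univ 0) (Set.mem_univ (s * γ)) (sub_nonneg.2 h1)
    (div_nonneg hx.1 hγ.le) (sub_add_cancel 1 _)
  simp only [smul_eq_mul, mul_zero, zero_add, exp_zero, mul_one] at h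
  rw [show x / γ * (s * γ) = s * x by field_simp] at h
  linarith

section
variable {Ω : Type*} {m m₀ : MeasurableSpace Ω} {P : Measure Ω}

/-- Markov's inequality, strict for the event that the threshold is strictly exceeded. -/
theorem mul_measureReal_lt_of_integral_le [IsFiniteMeasure P] {Y : Ω → ℝ} {a C : ℝ}
    (hY : Integrable Y P) (hY0 : 0 ≤ᵐ[P] Y)
    (hmeas : MeasurableSet {ω | a < Y ω}) (hC : 0 < C) (hYC : ∫ ω, Y ω ∂P ≤ C) :
    a * P.real {ω | a < Y ω} < C := by
  by_cases h0 : P {ω | a < Y ω} = 0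
  · simpa [Measure.real, h0]
  have hInt : Integrable ({ω | a < Y ω}.indicator fun _ ↦ a) P :=
    (integrable_const a).indicator hmeas
  have hpos : 0 < ∫ ω, (Y ω - {ω | a < Y ω}.indicator (fun _ ↦ a) ω) ∂P := by
    refine (integral_pos_iff_support_of_nonneg_ae ?_ (hY.sub hInt)).2 ?_
    · filter_upwards [hY0] with ω hω
      by_cases h : a < Y ω
      · simpa [h] using h.le
      · simpa [h] using hω
    · refine (pos_iff_ne_zero.2 h0).trans_le (measure_mono fun ω hω ↦ ?_)
      have hω' : a < Y ω := hω
      simpa [hω'] using (sub_pos.2 hω').ne'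
  rw [integral_sub hY hInt, integral_indicator_const _ hmeas, smul_eq_mul, mul_comm] at hpos
  linarith

variable [IsProbabilityMeasure P]

/-- Multiplying by `exp (s * g)`, where `g ∈ [0, γ]` has conditional mean at most `μ`, increases
the expectation of a nonnegative past-measurable variable by at most the Bernoulli factor. -/
theorem integral_mul_exp_le_of_condExp_le (hm : m ≤ m₀) {γ μ s : ℝ} (hγ : 0 < γ) (hs : 0 ≤ s)
    {Z g : Ω → ℝ} (hZm : StronglyMeasurable[m] Z) (hZ : Integrable Z P) (hZ0 : 0 ≤ Z)
    (hg : AEStronglyMeasurable g P) (hbd : ∀ᵐ ω ∂P, g ω ∈ Set.Icc 0 γ)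
    (hcond : ∀ᵐ ω ∂P, (P[g | m]) ω ≤ μ) :
    Integrable (fun ω ↦ Z ω * exp (s * g ω)) P ∧
      ∫ ω, Z ω * exp (s * g ω) ∂P ≤ (1 + μ / γ * (exp (s * γ) - 1)) * ∫ ω, Z ω ∂P := by
  have hgb : ∀ᵐ ω ∂P, ‖g ω‖ ≤ γ := by
    filter_upwards [hbd] with ω hω
    rw [norm_of_nonneg hω.1]
    exact hω.2
  have hgi : Integrable g P := .of_bound hg γ hgb
  have hZg : Integrable (fun ω ↦ Z ω * g ω) P := hZ.mul_bdd hg hgb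
  have hZe : Integrable (fun ω ↦ Z ω * exp (s * g ω)) P := by
    refine hZ.mul_bdd (c := exp (s * γ))
      (continuous_exp.comp_aestronglyMeasurable (hg.const_mul s)) ?_
    filter_upwards [hbd] with ω hω
    rw [norm_of_nonneg (exp_pos _).le]
    exact exp_le_exp.2 (mul_le_mul_of_nonneg_left hω.2 hs)
  refine ⟨hZe, ?_⟩
  have hpull : P[fun ω ↦ Z ω * g ω | m] =ᵐ[P] Z * P[g | m] :=
    condExp_mul_of_stronglyMeasurable_left hZm hZg hgi
  have hmean : ∫ ω, Z ω * g ω ∂P ≤ μ * ∫ ω, Z ω ∂P := by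
    rw [← integral_condExp hm, ← integral_const_mul]
    refine integral_mono_ae integrable_condExp (hZ.const_mul μ) ?_
    filter_upwards [hpull, hcond] with ω h1 h2
    rw [h1, Pi.mul_apply, mul_comm]
    exact mul_le_mul_of_nonneg_right h2 (hZ0 ω)
  have hexp : 0 ≤ (exp (s * γ) - 1) / γ :=
    div_nonneg (sub_nonneg.2 (one_le_exp (mul_nonneg hs hγ.le))) hγ.le
  calc ∫ ω, Z ω * exp (s * g ω) ∂P
      ≤ ∫ ω, (Z ω + (exp (s * γ) - 1) / γ * (Z ω * g ω)) ∂P := by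
        refine integral_mono_ae hZe (hZ.add (hZg.const_mul _)) ?_
        filter_upwards [hbd] with ω hω
        refine (mul_le_mul_of_nonneg_left (exp_mul_le_chord hγ hω) (hZ0 ω)).trans_eq ?_
        ring
    _ = ∫ ω, Z ω ∂P + (exp (s * γ) - 1) / γ * ∫ ω, Z ω * g ω ∂P := by
        rw [integral_add hZ (hZg.const_mul _), integral_const_mul]
    _ ≤ ∫ ω, Z ω ∂P + (exp (s * γ) - 1) / γ * (μ * ∫ ω, Z ω ∂P) := by gcongr
    _ = _ := by ring

/-- The moment generating function of a sum of adapted `[0, γ]`-valued variables with conditional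
means at most `μ` is bounded by that of a sum of independent scaled Bernoulli variables. -/
theorem integral_exp_sum_le_of_condExp_le {M : ℕ} {E : Fin M → Type*}
    [∀ i, MeasurableSpace (E i)] {X : ∀ i, Ω → E i} (hX : ∀ i, Measurable (X i))
    {γ μ s : ℝ} (hγ : 0 < γ) (hμ0 : 0 ≤ μ) (hs : 0 ≤ s) {f : Fin M → Ω → ℝ}
    (hmeas : ∀ i : Fin M,
      Measurable[⨆ j : Fin M, ⨆ _ : j ≤ i, MeasurableSpace.comap (X j) inferInstance] (f i))
    (hbd : ∀ i : Fin M, ∀ᵐ ω ∂P, f i ω ∈ Set.Icc 0 γ)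
    (hcond : ∀ i : Fin M, ∀ᵐ ω ∂P,
      (P[f i | ⨆ j : Fin M, ⨆ _ : j < i, MeasurableSpace.comap (X j) inferInstance]) ω ≤ μ) :
    Integrable (fun ω ↦ exp (s * ∑ i, f i ω)) P ∧
      ∫ ω, exp (s * ∑ i, f i ω) ∂P ≤ (1 + μ / γ * (exp (s * γ) - 1)) ^ M := by
  have hc : 0 ≤ 1 + μ / γ * (exp (s * γ) - 1) := by
    have := sub_nonneg.2 (one_le_exp (mul_nonneg hs hγ.le))
    positivity
  have initial_sums : ∀ k ≤ M,
      Integrable (fun ω ↦ exp (s * ∑ i with i.val < k, f i ω)) P ∧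
        ∫ ω, exp (s * ∑ i with i.val < k, f i ω) ∂P ≤
          (1 + μ / γ * (exp (s * γ) - 1)) ^ k := by
    intro k
    induction k with
    | zero => simp
    | succ k ih =>
      intro hk
      obtain ⟨hi, hle⟩ := ih (by omega)
      let i : Fin M := ⟨k, hk⟩
      have hsplit : ∀ ω, exp (s * ∑ j with j.val < k + 1, f j ω) =
          exp (s * ∑ j with j.val < k, f j ω) * exp (s * f i ω) := by
        intro ω
        have : (Finset.univ.filter fun j : Fin M ↦ j.val < k + 1) =
            insert i (Finset.univ.filter fun j : Fin M ↦ j.val < k) := by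
          ext j
          simp [i, Fin.ext_iff]
          omega
        rw [this, Finset.sum_insert (by simp [i]), ← exp_add]
        ring_nf
      have hstep := integral_mul_exp_le_of_condExp_le
        (m := ⨆ j : Fin M, ⨆ _ : j < i, MeasurableSpace.comap (X j) inferInstance)
        (iSup₂_le fun j _ ↦ (hX j).comap_le) hγ hs
        (Z := fun ω ↦ exp (s * ∑ j with j.val < k, f j ω))
        (by
          refine Measurable.stronglyMeasurable (measurable_exp.comp (Measurable.const_mul
            (Finset.measurable_sum _ fun j hj ↦ (hmeas j).mono ?_ le_rfl) s))
          have hji : j < i := by simpa [i, Fin.lt_def] using hj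
          exact iSup₂_le fun l hl ↦ le_iSup₂_of_le l (hl.trans_lt hji) le_rfl)
        hi (fun ω ↦ (exp_pos _).le)
        ((hmeas i).mono (iSup₂_le fun j _ ↦ (hX j).comap_le) le_rfl).aestronglyMeasurable
        (hbd i) (hcond i)
      simp only [hsplit]
      refine ⟨hstep.1, hstep.2.trans ?_⟩
      rw [pow_succ']
      exact mul_le_mul_of_nonneg_left hle hc
  simpa using initial_sums M le_rfl

end

/-- **Chernoff-type bound for dependent random variables with bounded conditional means**
(Lemma 1 of the paper, both loosened forms).
`X i : Ω → E i` are random variables; `f i` plays the role of `f_i(X_1,…,X_i)`: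
it is required to be measurable with respect to the σ-algebra generated by `X_0,…,X_i`,
to take values in `[0,γ]` a.s., and to have conditional expectation, given
`X_0,…,X_{i-1}`, at most `μ` a.s.  Then the empirical average exceeds `t ∈ [μ,γ]`
with probability strictly less than
`min { 2^{-M (t - μ log₂ e)/γ}, e^{-2M((t-μ)/γ)²} }`. -/
theorem chernoff_bounded_condexp_min
    {Ω : Type*} [MeasurableSpace Ω] (P : Measure Ω) [IsProbabilityMeasure P]
    {M : ℕ} (hM : 0 < M)
    {E : Fin M → Type*} [∀ i, MeasurableSpace (E i)]
    (X : ∀ i, Ω → E i) (hX : ∀ i, Measurable (X i))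
    (γ μ : ℝ) (hγ : 0 < γ) (hμ0 : 0 ≤ μ) (hμγ : μ ≤ γ)
    (f : Fin M → Ω → ℝ)
    (hmeas : ∀ i : Fin M,
      Measurable[⨆ j : Fin M, ⨆ _ : j ≤ i, MeasurableSpace.comap (X j) inferInstance] (f i))
    (hbd : ∀ i : Fin M, ∀ᵐ ω ∂P, f i ω ∈ Set.Icc 0 γ)
    (hcond : ∀ i : Fin M, ∀ᵐ ω ∂P,
      (P[f i | ⨆ j : Fin M, ⨆ _ : j < i, MeasurableSpace.comap (X j) inferInstance]) ω ≤ μ)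
    (t : ℝ) (ht : t ∈ Set.Icc μ γ) :
    (P {ω | t < (1 / (M : ℝ)) * ∑ i, f i ω}).toReal <
      min ((2 : ℝ) ^ (-(M : ℝ) * (t - μ * Real.logb 2 (Real.exp 1)) / γ))
        (Real.exp (-2 * (M : ℝ) * ((t - μ) / γ) ^ 2)) := by
  have hM' : (0 : ℝ) < M := by exact_mod_cast hM
  have hfm (i : Fin M) : Measurable (f i) :=
    (hmeas i).mono (iSup₂_le fun j _ ↦ (hX j).comap_le) le_rfl
  have hSm : Measurable fun ω ↦ ∑ i, f i ω := Finset.measurable_sum _ fun i _ ↦ hfm i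
  have chernoff {s b : ℝ} (hs : 0 < s) (hb : 1 + μ / γ * (exp (s * γ) - 1) ≤ exp b) :
      (P {ω | t < (1 / (M : ℝ)) * ∑ i, f i ω}).toReal < exp (M * (b - s * t)) := by
    obtain ⟨hInt, hle⟩ := integral_exp_sum_le_of_condExp_le hX hγ hμ0 hs.le hmeas hbd hcond
    have hset : {ω | t < (1 / (M : ℝ)) * ∑ i, f i ω} =
        {ω | exp (s * (M * t)) < exp (s * ∑ i, f i ω)} := by
      ext ω
      simp only [Set.mem_ofPred_eq, exp_lt_exp, mul_lt_mul_iff_right₀ hs]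
      rw [one_div, inv_mul_eq_div, lt_div_iff₀ hM', mul_comm]
    have hc : 0 ≤ 1 + μ / γ * (exp (s * γ) - 1) := by
      have := sub_nonneg.2 (one_le_exp (mul_nonneg hs.le hγ.le))
      positivity
    have h := mul_measureReal_lt_of_integral_le (a := exp (s * (M * t))) hInt
      (Filter.Eventually.of_forall fun ω ↦ (exp_pos _).le)
      (measurableSet_lt measurable_const (measurable_exp.comp (hSm.const_mul s)))
      (pow_pos (exp_pos b) M) (hle.trans (pow_le_pow_left₀ hc hb M))
    rw [hset]
    rw [mul_comm, ← lt_div_iff₀ (exp_pos _), ← exp_nat_mul, ← exp_sub] at h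
    refine h.trans_eq ?_
    ring_nf
  refine lt_min ?_ ?_
  · have hlog := log_pos one_lt_two
    refine (chernoff (s := log 2 / γ) (b := μ / γ) (by positivity) ?_).trans_eq ?_
    · rw [div_mul_cancel₀ _ hγ.ne', exp_log two_pos]
      linarith [add_one_le_exp (μ / γ)]
    · rw [rpow_def_of_pos two_pos, logb, log_exp]
      congr 1
      field_simp
      ring
  · rcases ht.1.eq_or_lt with rfl | htμ
    · have hfi (i : Fin M) : Integrable (f i) P :=
        Integrable.of_mem_Icc 0 γ (hfm i).aemeasurable (hbd i)
      have hmean (i : Fin M) : ∫ ω, f i ω ∂P ≤ μ := by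
        rw [← integral_condExp (m := ⨆ j : Fin M, ⨆ _ : j < i,
          MeasurableSpace.comap (X j) inferInstance) (iSup₂_le fun j _ ↦ (hX j).comap_le)]
        simpa using integral_mono_ae integrable_condExp (integrable_const μ) (hcond i)
      have hSi : Integrable (fun ω ↦ (1 / (M : ℝ)) * ∑ i, f i ω) P :=
        (integrable_finsetSum _ fun i _ ↦ hfi i).const_mul _
      have hSmean : ∫ ω, ((1 / (M : ℝ)) * ∑ i, f i ω + 1) ∂P ≤ μ + 1 := by
        rw [integral_add hSi (integrable_const _), integral_const_mul,
          integral_finsetSum _ fun i _ ↦ hfi i]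
        have : ∑ i, ∫ ω, f i ω ∂P ≤ M * μ := by
          simpa using Finset.sum_le_sum fun i (_ : i ∈ Finset.univ) ↦ hmean i
        have := mul_le_mul_of_nonneg_left this (one_div_pos.2 hM').le
        rw [← mul_assoc, one_div_mul_cancel hM'.ne', one_mul] at this
        simpa using this
      have h := mul_measureReal_lt_of_integral_le (a := μ + 1) (hSi.add (integrable_const 1))
        (by
          filter_upwards [ae_all_iff.2 hbd] with ω hω
          have := Finset.sum_nonneg fun i (_ : i ∈ Finset.univ) ↦ (hω i).1
          simp only [Pi.zero_apply, Pi.add_apply]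
          positivity)
        (measurableSet_lt measurable_const ((hSm.const_mul _).add_const 1))
        (by positivity) hSmean
      simp only [Pi.add_apply, add_lt_add_iff_right] at h
      have h1 := (mul_lt_iff_lt_one_right (by positivity)).1 h
      simpa [Measure.real] using h1
    · have hp : μ / γ ∈ unitInterval := ⟨div_nonneg hμ0 hγ.le, (div_le_one hγ).2 hμγ⟩
      refine (chernoff (s := 4 * (t - μ) / γ ^ 2)
        (div_pos (by linarith) (by positivity)) (bernoulli_mgf_le_exp hp _)).trans_eq ?_
      congr 1
      field_simp
      ring
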